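/- Let (G,c) be an edge-colored DAG and suppose ij ∈ E is a covered edge, i.e., pa_G(j) = pa_G(i) ∪ {i}. Suppose there exists an edge kℓ ∈ E with c(kℓ) = c(ij) and ℓ ∉ {i,j}. Let G_{i←j} be the DAG obtained from G by reversing the edge ij to ji (this is again a DAG since ij is covered), and define the edge-coloring c_{i←j} of G_{i←j} by c_{i←j}(e) = c(e) for every edge e ≠ ji of G_{i←j} and c_{i←j}(ji) = c(ij). Then M(G_{i←j}, c_{i←j}) ≠ M(G,c). -/

import Mathlib

open Matrix

/-- Principal minor `|Σ_A|`: determinant of the submatrix with rows and columns `A`. -/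
noncomputable def pminor {p : ℕ} {R : Type*} [CommRing R] (M : Matrix (Fin p) (Fin p) R)
    (A : Finset (Fin p)) : R :=
  (M.submatrix (fun a : {x // x ∈ A} => a.1) (fun a : {x // x ∈ A} => a.1)).det

/-- Almost-principal minor `|Σ_{ij|K}| = |Σ_{{i}∪K, {j}∪K}|`: determinant of the submatrix
with rows `{i} ∪ K` and columns `{j} ∪ K`, where `i` is matched with `j` and the elements
of `K` are matched with themselves. -/
noncomputable def cminor {p : ℕ} {R : Type*} [CommRing R] (M : Matrix (Fin p) (Fin p) R)
    (i j : Fin p) (K : Finset (Fin p)) : R :=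
  (M.submatrix (Sum.elim (fun _ : Unit => i) (fun k : {x // x ∈ K} => k.1))
               (Sum.elim (fun _ : Unit => j) (fun k : {x // x ∈ K} => k.1))).det

/-- The parametrization `φ_G(Ω,Λ) = (1-Λ)^{-T} Ω (1-Λ)⁻¹` of a Gaussian DAG model. -/
noncomputable def phiG {p : ℕ} (W L : Matrix (Fin p) (Fin p) ℝ) : Matrix (Fin p) (Fin p) ℝ :=
  ((1 - L)⁻¹)ᵀ * W * (1 - L)⁻¹

/-- The parents `pa_G(j) = {k : (k,j) ∈ E}` of a vertex `j` in the DAG with edge set `E`. -/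
def parents {p : ℕ} (E : Finset (Fin p × Fin p)) (j : Fin p) : Finset (Fin p) :=
  Finset.univ.filter (fun k => (k, j) ∈ E)

/-- A directed graph with edge set `E` is acyclic iff no vertex lies on a directed cycle. -/
def IsAcyclic {p : ℕ} (E : Finset (Fin p × Fin p)) : Prop :=
  ∀ i : Fin p, ¬ Relation.TransGen (fun a b => (a, b) ∈ E) i i

/-- `j` lies in `de̅_G(i) = {i} ∪ de_G(i)`, the closure of the descendants of `i`. -/
def InDescClosure {p : ℕ} (E : Finset (Fin p × Fin p)) (i j : Fin p) : Prop :=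
  j = i ∨ Relation.TransGen (fun a b => (a, b) ∈ E) i j

/-- The edge-colored Gaussian DAG model `M(G,c)` of an edge-colored DAG: each vertex has
its own (singleton) color class, so the error variances `ω` are unconstrained, while
`λ_{ij} = λ_{kℓ}` whenever `c(ij) = c(kℓ)`. -/
noncomputable def ecModel {p : ℕ} (E : Finset (Fin p × Fin p))
    (cE : Fin p × Fin p → ℕ) : Set (Matrix (Fin p) (Fin p) ℝ) :=
  {S | ∃ (ω : Fin p → ℝ) (L : Matrix (Fin p) (Fin p) ℝ),
    (∀ v, 0 < ω v) ∧ (∀ a b, (a, b) ∉ E → L a b = 0) ∧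
    (∀ e ∈ E, ∀ e' ∈ E, cE e = cE e' → L e.1 e.2 = L e'.1 e'.2) ∧
    S = phiG (Matrix.diagonal ω) L}

section Acyclic

variable {p : ℕ} {E : Finset (Fin p × Fin p)}

lemma IsAcyclic.wellFounded (hE : IsAcyclic E) :
    WellFounded (Relation.TransGen fun a b => (a, b) ∈ E) :=
  haveI : Std.Irrefl (Relation.TransGen fun a b => (a, b) ∈ E) := ⟨hE⟩
  Finite.wellFounded_of_trans_of_irrefl _

lemma IsAcyclic.not_mem_of_mem (hE : IsAcyclic E) {a b : Fin p} (h : (a, b) ∈ E) :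
    (b, a) ∉ E := fun h' => hE a (.tail (.single h) h')

/-- Reversing a covered edge of an acyclic graph preserves acyclicity. -/
lemma IsAcyclic.reverse_covered (hE : IsAcyclic E) {i j : Fin p}
    (hcov : parents E j = insert i (parents E i)) :
    IsAcyclic (insert (j, i) (E.erase (i, j))) := by
  set R : Fin p → Fin p → Prop := fun a b => (a, b) ∈ E.erase (i, j) with hR
  have hmono : ∀ a b, R a b → (a, b) ∈ E := fun a b h => Finset.mem_of_mem_erase h
  have hij : (i, j) ∈ E := by
    have : i ∈ parents E j := by simp [hcov]
    simpa [parents] using this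
  have key : ∀ a b, Relation.TransGen
      (fun a b => (a, b) ∈ insert (j, i) (E.erase (i, j))) a b →
      Relation.TransGen R a b ∨ (Relation.ReflTransGen R a j ∧ Relation.ReflTransGen R i b) := by
    intro a b h
    induction h with
    | single h =>
      rcases Finset.mem_insert.1 h with h | h
      · obtain ⟨rfl, rfl⟩ := Prod.mk.inj h
        exact .inr ⟨.refl, .refl⟩
      · exact .inl (.single h)
    | tail _ h ih =>
      rcases Finset.mem_insert.1 h with h | h
      · obtain ⟨rfl, rfl⟩ := Prod.mk.inj h
        exact .inr ⟨ih.elim (fun h => h.to_reflTransGen) (fun h => h.1), .refl⟩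
      · exact ih.imp (fun h' => h'.tail h) (fun h' => ⟨h'.1, h'.2.tail h⟩)
  intro a ha
  rcases key a a ha with h | ⟨h₁, h₂⟩
  · exact hE a (Relation.TransGen.mono hmono _ _ h)
  · rcases (h₂.trans h₁).cases_tail with h | ⟨c, hc, hcj⟩
    · exact hE i (.single (h ▸ hij))
    · have hci : c ≠ i := fun h => by simp [hR, h] at hcj
      have hc' : c ∈ insert i (parents E i) := by
        rw [← hcov]
        simpa [parents] using hmono _ _ hcj
      have hcE : (c, i) ∈ E := by simpa [parents, hci] using hc'
      exact hE i (.tail' (Relation.ReflTransGen.mono hmono _ _ hc) hcE)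

variable {L : Matrix (Fin p) (Fin p) ℝ}

lemma isUnit_det_one_sub (hE : IsAcyclic E) (hL : ∀ a b, (a, b) ∉ E → L a b = 0) :
    IsUnit (1 - L).det := by
  rw [isUnit_iff_ne_zero]
  intro h
  obtain ⟨v, hv, hv0⟩ := Matrix.exists_vecMul_eq_zero_iff.2 h
  refine hv (funext fun b => ?_)
  induction b using hE.wellFounded.induction with
  | _ b ih =>
    have hb : v b = ∑ c, v c * L c b := by
      have := congrFun hv0 b
      rw [Matrix.vecMul_sub, Matrix.vecMul_one] at this
      exact sub_eq_zero.1 this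
    rw [hb]
    refine Finset.sum_eq_zero fun c _ => ?_
    by_cases hc : (c, b) ∈ E
    · simp [ih c (.single hc)]
    · simp [hL c b hc]

lemma inv_one_sub_apply (hE : IsAcyclic E) (hL : ∀ a b, (a, b) ∉ E → L a b = 0) (a b : Fin p) :
    (1 - L)⁻¹ a b = (1 : Matrix (Fin p) (Fin p) ℝ) a b + ∑ c, (1 - L)⁻¹ a c * L c b := by
  have h := Matrix.nonsing_inv_mul (1 - L) (isUnit_det_one_sub hE hL)
  rw [mul_sub, mul_one, sub_eq_iff_eq_add] at h
  exact congrFun (congrFun h a) b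

lemma inv_one_sub_support (hE : IsAcyclic E) (hL : ∀ a b, (a, b) ∉ E → L a b = 0)
    {a b : Fin p} (h : (1 - L)⁻¹ a b ≠ 0) : InDescClosure E a b := by
  induction b using hE.wellFounded.induction with
  | _ b ih =>
    by_cases hba : b = a
    · exact .inl hba
    · rw [inv_one_sub_apply hE hL, Matrix.one_apply_ne' hba, zero_add] at h
      obtain ⟨c, -, hc⟩ := Finset.exists_ne_zero_of_sum_ne_zero h
      have hcb : (c, b) ∈ E := by
        by_contra hcb
        exact hc (by simp [hL c b hcb])
      rcases ih c (.single hcb) (left_ne_zero_of_mul hc) with rfl | hac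
      · exact .inr (.single hcb)
      · exact .inr (.tail hac hcb)

lemma inv_one_sub_eq_zero (hE : IsAcyclic E) (hL : ∀ a b, (a, b) ∉ E → L a b = 0)
    {a b : Fin p} (h : (b, a) ∈ E) : (1 - L)⁻¹ a b = 0 := by
  by_contra hne
  rcases inv_one_sub_support hE hL hne with rfl | hab
  · exact hE _ (.single h)
  · exact hE _ (.tail hab h)

lemma inv_one_sub_diag (hE : IsAcyclic E) (hL : ∀ a b, (a, b) ∉ E → L a b = 0) (a : Fin p) :
    (1 - L)⁻¹ a a = 1 := by
  rw [inv_one_sub_apply hE hL, Matrix.one_apply_eq, add_eq_left]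
  refine Finset.sum_eq_zero fun c _ => ?_
  by_cases hc : (c, a) ∈ E
  · simp [inv_one_sub_eq_zero hE hL hc]
  · simp [hL c a hc]

/-- The total effect along a covered edge is its edge coefficient. -/
lemma inv_one_sub_covered (hE : IsAcyclic E) (hL : ∀ a b, (a, b) ∉ E → L a b = 0)
    {i j : Fin p} (hij : (i, j) ∈ E) (hpa : ∀ c, (c, j) ∈ E ↔ c = i ∨ (c, i) ∈ E) :
    (1 - L)⁻¹ i j = L i j := by
  have hne : i ≠ j := fun h => hE i (.single (h ▸ hij))
  rw [inv_one_sub_apply hE hL, Matrix.one_apply_ne hne, zero_add,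
    Finset.sum_eq_single i _ (by simp), inv_one_sub_diag hE hL, one_mul]
  intro c _ hci
  by_cases hc : (c, i) ∈ E
  · simp [inv_one_sub_eq_zero hE hL hc]
  · simp [hL c j (by simp [hpa, hci, hc])]

lemma phiG_mulVec_col (hE : IsAcyclic E) (hL : ∀ a b, (a, b) ∉ E → L a b = 0)
    (ω : Fin p → ℝ) (a b : Fin p) :
    (phiG (diagonal ω) L *ᵥ (1 - L).col b) a = (1 - L)⁻¹ b a * ω b := by
  have h : phiG (diagonal ω) L * (1 - L) = ((1 - L)⁻¹)ᵀ * diagonal ω := by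
    rw [phiG, Matrix.mul_assoc, Matrix.nonsing_inv_mul _ (isUnit_det_one_sub hE hL),
      Matrix.mul_one]
  have h' := congrFun (congrFun h a) b
  rw [Matrix.mul_diagonal, Matrix.transpose_apply] at h'
  exact h'

/-- Uniqueness of solutions to the normal equations with regressor set `P`. -/
lemma eq_zero_of_phiG_mulVec_eq_zero (hE : IsAcyclic E)
    (hL : ∀ a b, (a, b) ∉ E → L a b = 0) (P : Fin p → Prop) {d : Fin p → ℝ}
    (hd : ∀ c, ¬ P c → d c = 0) (hS : ∀ c, P c → (phiG (diagonal fun _ => 1) L *ᵥ d) c = 0) :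
    d = 0 := by
  have hu := isUnit_det_one_sub hE hL
  have h0 : d ⬝ᵥ (phiG (diagonal fun _ => 1) L *ᵥ d) = 0 := by
    refine Finset.sum_eq_zero fun c _ => ?_
    by_cases hc : P c
    · rw [hS c hc, mul_zero]
    · rw [hd c hc, zero_mul]
  rw [phiG, Matrix.diagonal_one, Matrix.mul_one, ← Matrix.mulVec_mulVec,
    Matrix.dotProduct_mulVec, Matrix.vecMul_transpose, dotProduct_self_eq_zero] at h0
  calc d = (1 - L) *ᵥ ((1 - L)⁻¹ *ᵥ d) := by
        rw [Matrix.mulVec_mulVec, Matrix.mul_nonsing_inv _ hu, Matrix.one_mulVec]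
    _ = 0 := by rw [h0, Matrix.mulVec_zero]

end Acyclic

/-- Covered edge reversals change edge-colored models.
Let `(G,c)` be an edge-colored DAG, `ij ∈ E` a covered edge
(`pa_G(j) = pa_G(i) ∪ {i}`), and suppose there is an edge `kℓ ∈ E` with
`c(kℓ) = c(ij)` and `ℓ ∉ {i,j}`.  Let `G_{i←j}` be obtained from `G` by reversing the
edge `ij` to `ji`, colored by `c_{i←j}` which agrees with `c` except that
`c_{i←j}(ji) = c(ij)`.  Then `M(G_{i←j}, c_{i←j}) ≠ M(G, c)`. -/
theorem covered_edge_reversal_changes_model {p : ℕ}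
    (E : Finset (Fin p × Fin p)) (hE : IsAcyclic E) (cE : Fin p × Fin p → ℕ)
    (i j : Fin p) (hij : (i, j) ∈ E)
    (hcov : parents E j = insert i (parents E i))
    (k l : Fin p) (hkl : (k, l) ∈ E) (hcol : cE (k, l) = cE (i, j))
    (hli : l ≠ i) (hlj : l ≠ j)
    (E' : Finset (Fin p × Fin p)) (hE' : E' = insert (j, i) (E.erase (i, j)))
    (cE' : Fin p × Fin p → ℕ)
    (hcE' : ∀ e, cE' e = if e = (j, i) then cE (i, j) else cE e) :
    ecModel E' cE' ≠ ecModel E cE := by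
  have hne : i ≠ j := fun h => hE i (.single (h ▸ hij))
  have hpa : ∀ c, (c, j) ∈ E ↔ c = i ∨ (c, i) ∈ E := fun c => by
    have := Finset.ext_iff.1 hcov c
    simpa [parents] using this
  have hacyc : IsAcyclic E' := hE' ▸ hE.reverse_covered hcov
  have hmem : ∀ a b, (a, b) ∈ E' ↔ (a = j ∧ b = i) ∨ (¬(a = i ∧ b = j) ∧ (a, b) ∈ E) :=
    fun a b => by simp [hE']
  have hjj : (j, j) ∉ E := fun h => hE j (.single h)
  have hii : (i, i) ∉ E := fun h => hE i (.single h)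
  have hii' : (i, i) ∉ E' := fun h => hacyc i (.single h)
  have hji : (j, i) ∉ E := hE.not_mem_of_mem hij
  have hji' : (j, i) ∈ E' := by simp [hmem]
  have hkl' : (k, l) ∈ E' := by simp [hmem, hlj, hkl]
  intro hEq
  let L : Matrix (Fin p) (Fin p) ℝ := fun a b => if (a, b) ∈ E then 1 else 0
  have hL : ∀ a b, (a, b) ∉ E → L a b = 0 := fun a b h => if_neg h
  have hL1 : ∀ a b, (a, b) ∈ E → L a b = 1 := fun a b h => if_pos h
  have hS : phiG (diagonal fun _ => 1) L ∈ ecModel E cE :=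
    ⟨fun _ => 1, L, fun _ => one_pos, hL,
      fun e he e' he' _ => by rw [hL1 _ _ he, hL1 _ _ he'], rfl⟩
  rw [← hEq] at hS
  obtain ⟨ω', L', -, hL', hc', hS⟩ := hS
  have hcoef : L' k l = L' j i := hc' (k, l) hkl' (j, i) hji' (by simp [hcE', hcol, hli])
  have hSx : ∀ a b, (phiG (diagonal fun _ => 1) L *ᵥ (1 - L).col b) a = (1 - L)⁻¹ b a :=
    fun a b => by rw [phiG_mulVec_col hE hL, mul_one]
  have hSx' : ∀ a b, (phiG (diagonal fun _ => 1) L *ᵥ (1 - L').col b) a =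
      (1 - L')⁻¹ b a * ω' b :=
    fun a b => by rw [hS, phiG_mulVec_col hacyc hL']
  -- Regressing `l` on its parents identifies the coefficient `L' k l`.
  have h₁ : (1 - L').col l - (1 - L).col l = 0 := by
    have hl : ∀ c, (c, l) ∈ E' ↔ (c, l) ∈ E := fun c => by simp [hmem, hli, hlj]
    refine eq_zero_of_phiG_mulVec_eq_zero hE hL (fun c => (c, l) ∈ E) (fun c hc => ?_)
      fun c hc => ?_
    · simp [hL c l hc, hL' c l (mt (hl c).1 hc)]
    · rw [Matrix.mulVec_sub, Pi.sub_apply, hSx, hSx', inv_one_sub_eq_zero hE hL hc,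
        inv_one_sub_eq_zero hacyc hL' ((hl c).2 hc), zero_mul, sub_zero]
  -- Regressing `i` on its parents in the reversed graph identifies the coefficient `L' j i`.
  have h₂ : (1 - L').col i - (2⁻¹ : ℝ) • ((1 - L).col i - (1 - L).col j) = 0 := by
    refine eq_zero_of_phiG_mulVec_eq_zero hE hL (fun c => (c, i) ∈ E ∨ c = j) (fun c hc => ?_)
      fun c hc => ?_
    · obtain ⟨hci, hcj⟩ := not_or.1 hc
      by_cases h : c = i
      · subst h
        simp [hL c c hii, hL' c c hii', hL1 c j hij, hne]
        norm_num
      · simp [h, hcj, hL c i hci, hL c j (by simp [hpa, h, hci]),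
          hL' c i (by simp [hmem, hcj, hci])]
    · rw [Matrix.mulVec_sub, Matrix.mulVec_smul, Matrix.mulVec_sub, Pi.sub_apply, Pi.smul_apply,
        Pi.sub_apply, hSx, hSx, hSx']
      rcases hc with hc | rfl
      · simp [inv_one_sub_eq_zero hE hL hc, inv_one_sub_eq_zero hE hL ((hpa c).2 (.inr hc)),
          inv_one_sub_eq_zero hacyc hL' ((hmem c i).2 (.inr ⟨by simp [hne], hc⟩))]
      · simp [inv_one_sub_eq_zero hacyc hL' hji', inv_one_sub_diag hE hL,
          inv_one_sub_covered hE hL hij hpa, hL1 _ _ hij]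
  have e₁ := congrFun h₁ k
  have e₂ := congrFun h₂ j
  simp only [Pi.sub_apply, Pi.smul_apply, Matrix.col_apply, Matrix.sub_apply, Matrix.one_apply_eq,
    Matrix.one_apply_ne hne.symm, hL j i hji, hL j j hjj, hL1 k l hkl, Pi.zero_apply,
    smul_eq_mul] at e₁ e₂
  linarith
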